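/- Let ABC be a nondegenerate triangle in ℂ. Let P and P′ be distinct isogonal conjugates with respect to ABC, let Q ≠ P lie on line PP′, and let Q′ be the isogonal conjugate of Q with respect to ABC, with Q′ ≠ P. Assume no three of A, B, C, P, Q are collinear. Then the line PQ′ is tangent to the conic (ABCPQ) at P. -/

import Mathlib

noncomputable section

/-- The line through the points `u` and `v`. -/
def lineThrough (u v : ℂ) : Set ℂ := {z : ℂ | ∃ t : ℝ, z = u + t • (v - u)}

/-- A subset of `ℂ` is a line if it is the line through two distinct points. -/
def IsLine (L : Set ℂ) : Prop := ∃ u v : ℂ, u ≠ v ∧ L = lineThrough u v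

/-- The circle with center `O` and radius `r`. -/
def circleSet (O : ℂ) (r : ℝ) : Set ℂ := {z : ℂ | ‖z - O‖ = r}

/-- The value at `z` of the real quadratic polynomial with coefficients `a, b, c, d, e, f`
in the coordinates `x = Re z`, `y = Im z`. -/
def conicEval (a b c d e f : ℝ) (z : ℂ) : ℝ :=
  a * z.re ^ 2 + b * z.re * z.im + c * z.im ^ 2 + d * z.re + e * z.im + f

/-- The gradient at `z` of the real quadratic polynomial with coefficients
`a, b, c, d, e, f`, regarded as a complex number. -/
def conicGrad (a b c d e f : ℝ) (z : ℂ) : ℂ :=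
  ((2 * a * z.re + b * z.im + d : ℝ) : ℂ) + ((b * z.re + 2 * c * z.im + e : ℝ) : ℂ) * Complex.I

/-- A conic: the zero set of a nonzero real polynomial of total degree at most 2 in the
coordinates `x = Re z`, `y = Im z`. -/
def IsConic (S : Set ℂ) : Prop :=
  ∃ a b c d e f : ℝ, ¬(a = 0 ∧ b = 0 ∧ c = 0 ∧ d = 0 ∧ e = 0 ∧ f = 0) ∧
    S = {z : ℂ | conicEval a b c d e f z = 0}

/-- The line through `Z` perpendicular to the (nonzero) vector `g`. -/
def perpLineAt (Z g : ℂ) : Set ℂ :=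
  {w : ℂ | (w - Z).re * g.re + (w - Z).im * g.im = 0}

/-- `L` is the tangent line of the conic `S` at the point `Z`: for some defining polynomial
`f` of `S` vanishing at `Z` with `∇f(Z) ≠ 0`, `L` is the line through `Z` perpendicular
to `∇f(Z)`. -/
def IsConicTangentLineAt (S : Set ℂ) (Z : ℂ) (L : Set ℂ) : Prop :=
  ∃ a b c d e f : ℝ, ¬(a = 0 ∧ b = 0 ∧ c = 0 ∧ d = 0 ∧ e = 0 ∧ f = 0) ∧
    S = {z : ℂ | conicEval a b c d e f z = 0} ∧
    conicEval a b c d e f Z = 0 ∧ conicGrad a b c d e f Z ≠ 0 ∧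
    L = perpLineAt Z (conicGrad a b c d e f Z)

/-- The circle with center `O` and radius `r` and the conic `S` are tangent at `Z`:
both pass through `Z` and the tangent line of the circle at `Z` (the line through `Z`
perpendicular to the radius) is the tangent line of the conic at `Z`. -/
def CircleConicTangentAt (O : ℂ) (r : ℝ) (S : Set ℂ) (Z : ℂ) : Prop :=
  Z ∈ circleSet O r ∧ Z ∈ S ∧ IsConicTangentLineAt S Z (perpLineAt Z (Z - O))

/-- `P` and `P'` are isogonal conjugates with respect to the triangle `ABC`. -/
def IsogConj (A B C P P' : ℂ) : Prop :=
  ((P - A) * (P' - A) / ((B - A) * (C - A))).im = 0 ∧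
  ((P - B) * (P' - B) / ((C - B) * (A - B))).im = 0 ∧
  ((P - C) * (P' - C) / ((A - C) * (B - C))).im = 0

/-- No three of the points in the list `l` are collinear. -/
def NoThreeCollinear (l : List ℂ) : Prop :=
  ∀ i j k : Fin l.length, i ≠ j → i ≠ k → j ≠ k →
    ¬ Collinear ℝ ({l.get i, l.get j, l.get k} : Set ℂ)

/-- Four points lie on a common circle. -/
def Concyclic4 (A B C D : ℂ) : Prop :=
  ∃ O : ℂ, ∃ r : ℝ, 0 < r ∧ A ∈ circleSet O r ∧ B ∈ circleSet O r ∧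
    C ∈ circleSet O r ∧ D ∈ circleSet O r

/-- Orthogonal reflection of `z` across the line through `u` with direction `v`. -/
def reflAcross (u v z : ℂ) : ℂ :=
  u + v / (starRingEnd ℂ) v * (starRingEnd ℂ) (z - u)

/-- `O'` is a center of `S`: the point reflection about `O'` maps `S` onto itself. -/
def IsCenter (S : Set ℂ) (O' : ℂ) : Prop :=
  (fun z => 2 * O' - z) '' S = S


/-- The cross product of `u` and `v` regarded as plane vectors. -/
def planeCross (u v : ℂ) : ℝ := u.re * v.im - u.im * v.re

/-- `X` has barycentric coordinates `x, y, z` with respect to `A, B, C`. -/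
def HasBarycentric (A B C X : ℂ) (x y z : ℝ) : Prop :=
  x + y + z = 1 ∧ X.re = x * A.re + y * B.re + z * C.re ∧ X.im = x * A.im + y * B.im + z * C.im

lemma eq_smul_of_planeCross_eq_zero {u w : ℂ} (hu : u ≠ 0) (h : planeCross u w = 0) :
    ∃ t : ℝ, w = t • u := by
  have hn : u.re ^ 2 + u.im ^ 2 ≠ 0 := by
    rw [sq, sq, ← Complex.normSq_apply]
    exact mt Complex.normSq_eq_zero.1 hu
  refine ⟨(u.re * w.re + u.im * w.im) / (u.re ^ 2 + u.im ^ 2), ?_⟩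
  unfold planeCross at h
  apply Complex.ext
  · simp only [Complex.smul_re, smul_eq_mul]
    field_simp
    linear_combination (-u.im) * h
  · simp only [Complex.smul_im, smul_eq_mul]
    field_simp
    linear_combination u.re * h

lemma collinear_of_planeCross_eq_zero {X Y Z : ℂ} (h : planeCross (Y - X) (Z - X) = 0) :
    Collinear ℝ ({X, Y, Z} : Set ℂ) := by
  by_cases hYX : Y = X
  · subst hYX
    simpa using collinear_pair ℝ Y Z
  · obtain ⟨t, ht⟩ := eq_smul_of_planeCross_eq_zero (sub_ne_zero.2 hYX) h
    rw [collinear_iff_of_mem (p₀ := X) (by simp)]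
    refine ⟨Y - X, ?_⟩
    rintro p (rfl | rfl | rfl)
    · exact ⟨0, by simp⟩
    · exact ⟨1, by simp⟩
    · exact ⟨t, by rw [← ht]; simp⟩

lemma exists_hasBarycentric {A B C : ℂ} (hD : planeCross (B - A) (C - A) ≠ 0) (X : ℂ) :
    ∃ x y z : ℝ, HasBarycentric A B C X x y z := by
  refine ⟨1 - planeCross (X - A) (C - A) / planeCross (B - A) (C - A)
      - planeCross (B - A) (X - A) / planeCross (B - A) (C - A),
    planeCross (X - A) (C - A) / planeCross (B - A) (C - A),
    planeCross (B - A) (X - A) / planeCross (B - A) (C - A), by ring, ?_, ?_⟩ <;>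
  · field_simp
    simp only [planeCross, Complex.sub_re, Complex.sub_im]
    ring

lemma HasBarycentric.rotate {A B C X : ℂ} {x y z : ℝ} (h : HasBarycentric A B C X x y z) :
    HasBarycentric B C A X y z x :=
  ⟨by linarith [h.1], by linarith [h.2.1], by linarith [h.2.2]⟩

lemma HasBarycentric.planeCross_eq {A B C X Y : ℂ} {x y z x₂ y₂ z₂ : ℝ}
    (hX : HasBarycentric A B C X x y z) (hY : HasBarycentric A B C Y x₂ y₂ z₂) :
    planeCross (X - A) (Y - A) = (y * z₂ - z * y₂) * planeCross (B - A) (C - A) := by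
  obtain ⟨h1, h2, h3⟩ := hX
  obtain ⟨k1, k2, k3⟩ := hY
  obtain rfl : x = 1 - y - z := by linarith
  obtain rfl : x₂ = 1 - y₂ - z₂ := by linarith
  simp only [planeCross, Complex.sub_re, Complex.sub_im, h2, h3, k2, k3]
  ring

lemma planeCross_rotate (A B C : ℂ) :
    planeCross (C - B) (A - B) = planeCross (B - A) (C - A) := by
  simp only [planeCross, Complex.sub_re, Complex.sub_im]
  ring

/-- The isogonality condition at the vertex `A` in barycentric coordinates. -/
lemma HasBarycentric.isogonal_at_vertex {A B C X X' : ℂ} {x y z x' y' z' : ℝ}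
    (hD : planeCross (B - A) (C - A) ≠ 0)
    (hX : HasBarycentric A B C X x y z) (hX' : HasBarycentric A B C X' x' y' z')
    (h : ((X - A) * (X' - A) / ((B - A) * (C - A))).im = 0) :
    y * y' * Complex.normSq (B - A) = z * z' * Complex.normSq (C - A) := by
  have hB : B - A ≠ 0 := by
    intro h0
    simp [planeCross, h0] at hD
  have hC : C - A ≠ 0 := by
    intro h0
    simp [planeCross, h0] at hD
  have hN : Complex.normSq ((B - A) * (C - A)) ≠ 0 := by
    simpa using And.intro hB hC
  rw [Complex.div_im, ← sub_div, div_eq_zero_iff, or_iff_left hN] at h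
  obtain ⟨h1, h2, h3⟩ := hX
  obtain ⟨k1, k2, k3⟩ := hX'
  obtain rfl : x = 1 - y - z := by linarith
  obtain rfl : x' = 1 - y' - z' := by linarith
  refine mul_left_cancel₀ hD ?_
  simp only [planeCross, Complex.normSq_apply, Complex.sub_re, Complex.sub_im, Complex.mul_re,
    Complex.mul_im, h2, h3, k2, k3] at h ⊢
  linear_combination -h

/-- Isogonal conjugates have barycentric coordinates with product proportional to the squared
side lengths. -/
lemma IsogConj.exists_eq_div {A B C X X' : ℂ} {x y z x' y' z' : ℝ}
    (hD : planeCross (B - A) (C - A) ≠ 0) (hXX' : IsogConj A B C X X')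
    (hX : HasBarycentric A B C X x y z) (hX' : HasBarycentric A B C X' x' y' z')
    (hx : x ≠ 0) (hy : y ≠ 0) (hz : z ≠ 0) :
    ∃ k : ℝ, k ≠ 0 ∧ x' = k * Complex.normSq (C - B) / x ∧
      y' = k * Complex.normSq (C - A) / y ∧ z' = k * Complex.normSq (B - A) / z := by
  have hA := hX.isogonal_at_vertex hD hX' hXX'.1
  have hB := hX.rotate.isogonal_at_vertex (by rwa [planeCross_rotate]) hX'.rotate hXX'.2.1
  have hn : Complex.normSq (B - A) ≠ 0 := by
    rw [Ne, Complex.normSq_eq_zero]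
    intro h0
    simp [planeCross, h0] at hD
  rw [show Complex.normSq (A - B) = Complex.normSq (B - A) by
    rw [← Complex.normSq_neg, neg_sub]] at hB
  have ex : x' = z * z' / Complex.normSq (B - A) * Complex.normSq (C - B) / x := by
    field_simp
    linarith
  have ey : y' = z * z' / Complex.normSq (B - A) * Complex.normSq (C - A) / y := by
    field_simp
    linarith
  have ez : z' = z * z' / Complex.normSq (B - A) * Complex.normSq (B - A) / z := by
    field_simp
  refine ⟨_, ?_, ex, ey, ez⟩
  intro h0
  rw [h0] at ex ey ez
  have := hX'.1
  simp only [zero_mul, zero_div] at ex ey ez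
  linarith

/-- The circumconic `p y z + q z x + r x y = 0` through two points `(x, y, z)` and
`(x₂, y₂, z₂)`, the second lying on the line joining the first to its isogonal conjugate
`(α / x, β / y, γ / z)`: the points `(x, y, z)` and `(α / x₂, β / y₂, γ / z₂)` are conjugate
with respect to the conic. -/
lemma circumconic_polar_eq_zero {p q r x y z x₂ y₂ z₂ α β γ : ℝ}
    (hx : x ≠ 0) (hy : y ≠ 0) (hz : z ≠ 0) (hx₂ : x₂ ≠ 0) (hy₂ : y₂ ≠ 0) (hz₂ : z₂ ≠ 0)
    (hne : y * z₂ - z * y₂ ≠ 0)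
    (h₁ : p * (y * z) + q * (z * x) + r * (x * y) = 0)
    (h₂ : p * (y₂ * z₂) + q * (z₂ * x₂) + r * (x₂ * y₂) = 0)
    (hdet : α / x * (y * z₂ - z * y₂) + β / y * (z * x₂ - x * z₂) +
      γ / z * (x * y₂ - y * x₂) = 0) :
    p * (y * (γ / z₂) + z * (β / y₂)) + q * (z * (α / x₂) + x * (γ / z₂)) +
      r * (x * (β / y₂) + y * (α / x₂)) = 0 := by
  have hq : q * (x * x₂ * (y * z₂ - z * y₂)) = p * (y * y₂ * (z * x₂ - x * z₂)) := by
    linear_combination (-x₂ * y₂) * h₁ + (x * y) * h₂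
  have hr : r * (x * x₂ * (y * z₂ - z * y₂)) = p * (z * z₂ * (x * y₂ - y * x₂)) := by
    linear_combination (x₂ * z₂) * h₁ - (x * z) * h₂
  have hdet' : α * (y * z) * (y * z₂ - z * y₂) + β * (z * x) * (z * x₂ - x * z₂) +
      γ * (x * y) * (x * y₂ - y * x₂) = 0 := by
    field_simp at hdet
    linear_combination hdet
  obtain ⟨α', rfl⟩ : ∃ α', α = α' * x₂ := ⟨α / x₂, by field_simp⟩
  obtain ⟨β', rfl⟩ : ∃ β', β = β' * y₂ := ⟨β / y₂, by field_simp⟩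
  obtain ⟨γ', rfl⟩ : ∃ γ', γ = γ' * z₂ := ⟨γ / z₂, by field_simp⟩
  simp only [mul_div_cancel_right₀ _ hx₂, mul_div_cancel_right₀ _ hy₂,
    mul_div_cancel_right₀ _ hz₂]
  refine mul_left_cancel₀ (mul_ne_zero (mul_ne_zero hx hx₂) hne) ?_
  linear_combination (z * α' + x * γ') * hq + (x * β' + y * α') * hr - p * hdet'

lemma conicEval_barycentric {a b c d e f : ℝ} {A B C X : ℂ} {x y z : ℝ}
    (hX : HasBarycentric A B C X x y z) (hA : conicEval a b c d e f A = 0)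
    (hB : conicEval a b c d e f B = 0) (hC : conicEval a b c d e f C = 0) :
    conicEval a b c d e f X = -(conicEval a b c 0 0 0 (C - B) * (y * z) +
      conicEval a b c 0 0 0 (C - A) * (z * x) + conicEval a b c 0 0 0 (B - A) * (x * y)) := by
  obtain ⟨h1, h2, h3⟩ := hX
  obtain rfl : x = 1 - y - z := by linarith
  simp only [conicEval, Complex.sub_re, Complex.sub_im, h2, h3] at *
  linear_combination (1 - y - z) * hA + y * hB + z * hC

lemma conicGrad_barycentric {a b c d e f : ℝ} {A B C X Y : ℂ} {x y z x₂ y₂ z₂ : ℝ}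
    (hX : HasBarycentric A B C X x y z) (hY : HasBarycentric A B C Y x₂ y₂ z₂)
    (hA : conicEval a b c d e f A = 0)
    (hB : conicEval a b c d e f B = 0) (hC : conicEval a b c d e f C = 0)
    (hXf : conicEval a b c d e f X = 0) :
    (Y - X).re * (conicGrad a b c d e f X).re + (Y - X).im * (conicGrad a b c d e f X).im =
      -(conicEval a b c 0 0 0 (C - B) * (y * z₂ + z * y₂) +
      conicEval a b c 0 0 0 (C - A) * (z * x₂ + x * z₂) +
      conicEval a b c 0 0 0 (B - A) * (x * y₂ + y * x₂)) := by
  obtain ⟨h1, h2, h3⟩ := hX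
  obtain ⟨k1, k2, k3⟩ := hY
  obtain rfl : x = 1 - y - z := by linarith
  obtain rfl : x₂ = 1 - y₂ - z₂ := by linarith
  simp only [conicEval, conicGrad, Complex.sub_re, Complex.sub_im, Complex.add_re, Complex.add_im,
    Complex.mul_re, Complex.mul_im, Complex.ofReal_re, Complex.ofReal_im, Complex.I_re,
    Complex.I_im, h2, h3, k2, k3] at *
  linear_combination (1 - y - z + (1 - y₂ - z₂)) * hA + (y + y₂) * hB + (z + z₂) * hC - 2 * hXf

lemma conicEval_coeffs_eq_zero {a b c d e f : ℝ} (h : ∀ z, conicEval a b c d e f z = 0) :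
    a = 0 ∧ b = 0 ∧ c = 0 ∧ d = 0 ∧ e = 0 ∧ f = 0 := by
  have h0 := h 0
  have h1 := h 1
  have h2 := h (-1)
  have h3 := h Complex.I
  have h4 := h (-Complex.I)
  have h5 := h (1 + Complex.I)
  simp [conicEval] at h0 h1 h2 h3 h4 h5
  refine ⟨?_, ?_, ?_, ?_, ?_, ?_⟩ <;> linarith

lemma lineThrough_eq_perpLineAt {P R g : ℂ} (hR : R ≠ P) (hg : g ≠ 0)
    (h : (R - P).re * g.re + (R - P).im * g.im = 0) :
    lineThrough P R = perpLineAt P g := by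
  ext w
  constructor
  · rintro ⟨t, rfl⟩
    simp only [perpLineAt, Set.mem_ofPred_eq, add_sub_cancel_left, Complex.smul_re,
      Complex.smul_im, smul_eq_mul]
    linear_combination t * h
  · intro hw
    simp only [perpLineAt, Set.mem_ofPred_eq] at hw
    have hc : planeCross (R - P) (w - P) = 0 := by
      by_contra hne
      refine hg (Complex.ext ?_ ?_)
      · refine (mul_eq_zero.1 ?_).resolve_left hne
        unfold planeCross
        linear_combination (w - P).im * h - (R - P).im * hw
      · refine (mul_eq_zero.1 ?_).resolve_left hne
        unfold planeCross
        linear_combination (R - P).re * hw - (w - P).re * h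
    obtain ⟨t, ht⟩ := eq_smul_of_planeCross_eq_zero (sub_ne_zero.2 hR) hc
    exact ⟨t, by rw [← ht]; ring⟩

theorem statement14 (A B C : ℂ) (hABC : ¬ Collinear ℝ ({A, B, C} : Set ℂ))
    (P P' : ℂ) (hPP : P ≠ P') (hP : IsogConj A B C P P')
    (Q : ℂ) (hQP : Q ≠ P) (hQline : Q ∈ lineThrough P P')
    (Q' : ℂ) (hQ : IsogConj A B C Q Q') (hQ'P : Q' ≠ P)
    (h5 : NoThreeCollinear [A, B, C, P, Q])
    (S : Set ℂ) (hS : IsConic S)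
    (hAS : A ∈ S) (hBS : B ∈ S) (hCS : C ∈ S) (hPS : P ∈ S) (hQS : Q ∈ S) :
    IsConicTangentLineAt S P (lineThrough P Q') := by
  obtain ⟨a, b, c, d, e, f, hne, rfl⟩ := hS
  simp only [Set.mem_ofPred_eq] at hAS hBS hCS hPS hQS
  have hD : planeCross (B - A) (C - A) ≠ 0 := fun h => hABC (collinear_of_planeCross_eq_zero h)
  obtain ⟨x, y, z, bP⟩ := exists_hasBarycentric hD P
  obtain ⟨x', y', z', bP'⟩ := exists_hasBarycentric hD P'
  obtain ⟨t, ht⟩ := hQline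
  obtain ⟨x₂, y₂, z₂, bQ, ex, ey, ez⟩ : ∃ x₂ y₂ z₂ : ℝ, HasBarycentric A B C Q x₂ y₂ z₂ ∧
      x₂ = x + t * (x' - x) ∧ y₂ = y + t * (y' - y) ∧ z₂ = z + t * (z' - z) := by
    refine ⟨_, _, _, ⟨?_, ?_, ?_⟩, rfl, rfl, rfl⟩
    · linear_combination (1 - t) * bP.1 + t * bP'.1
    · simp only [ht, Complex.add_re, Complex.smul_re, Complex.sub_re, smul_eq_mul]
      linear_combination (1 - t) * bP.2.1 + t * bP'.2.1
    · simp only [ht, Complex.add_im, Complex.smul_im, Complex.sub_im, smul_eq_mul]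
      linear_combination (1 - t) * bP.2.2 + t * bP'.2.2
  obtain ⟨x₂', y₂', z₂', bQ'⟩ := exists_hasBarycentric hD Q'
  have bA : HasBarycentric A B C A 1 0 0 := ⟨by ring, by ring, by ring⟩
  have bB : HasBarycentric A B C B 0 1 0 := ⟨by ring, by ring, by ring⟩
  have bC : HasBarycentric A B C C 0 0 1 := ⟨by ring, by ring, by ring⟩
  have cross_ne : ∀ {X Y : ℂ} {s t u s₂ t₂ u₂ : ℝ}, HasBarycentric A B C X s t u →
      HasBarycentric A B C Y s₂ t₂ u₂ → ¬ Collinear ℝ ({A, X, Y} : Set ℂ) →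
      t * u₂ - u * t₂ ≠ 0 := by
    intro X Y s t u s₂ t₂ u₂ hX hY hcol h0
    refine hcol (collinear_of_planeCross_eq_zero ?_)
    rw [hX.planeCross_eq hY, h0, zero_mul]
  have coord_ne : ∀ {X : ℂ} {s t u : ℝ}, HasBarycentric A B C X s t u →
      ¬ Collinear ℝ ({A, B, X} : Set ℂ) → ¬ Collinear ℝ ({A, C, X} : Set ℂ) →
      ¬ Collinear ℝ ({B, C, X} : Set ℂ) → s ≠ 0 ∧ t ≠ 0 ∧ u ≠ 0 := by
    intro X s t u hX h₁ h₂ h₃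
    refine ⟨fun h0 => h₃ (collinear_of_planeCross_eq_zero ?_),
      fun h0 => cross_ne bC hX h₂ (by rw [h0]; ring),
      fun h0 => cross_ne bB hX h₁ (by rw [h0]; ring)⟩
    rw [bC.rotate.planeCross_eq hX.rotate, h0]
    ring
  replace h5 : ∀ i j k : Fin 5, i ≠ j → i ≠ k → j ≠ k → ¬ Collinear ℝ
      ({[A, B, C, P, Q].get i, [A, B, C, P, Q].get j, [A, B, C, P, Q].get k} : Set ℂ) := h5
  obtain ⟨hx, hy, hz⟩ := coord_ne bP
    (h5 0 1 3 (by decide) (by decide) (by decide)) (h5 0 2 3 (by decide) (by decide) (by decide))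
    (h5 1 2 3 (by decide) (by decide) (by decide))
  obtain ⟨hx₂, hy₂, hz₂⟩ := coord_ne bQ
    (h5 0 1 4 (by decide) (by decide) (by decide)) (h5 0 2 4 (by decide) (by decide) (by decide))
    (h5 1 2 4 (by decide) (by decide) (by decide))
  have hcross := cross_ne bP bQ (h5 0 3 4 (by decide) (by decide) (by decide))
  have hdet : x' * (y * z₂ - z * y₂) + y' * (z * x₂ - x * z₂) + z' * (x * y₂ - y * x₂) = 0 := by
    rw [ex, ey, ez]
    ring
  obtain ⟨k, hk, hx', hy', hz'⟩ := hP.exists_eq_div hD bP bP' hx hy hz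
  obtain ⟨m, -, hx₂', hy₂', hz₂'⟩ := hQ.exists_eq_div hD bQ bQ' hx₂ hy₂ hz₂
  have hfP := hPS
  have hfQ := hQS
  rw [conicEval_barycentric bP hAS hBS hCS, neg_eq_zero] at hfP
  rw [conicEval_barycentric bQ hAS hBS hCS, neg_eq_zero] at hfQ
  have hpolar := circumconic_polar_eq_zero (α := Complex.normSq (C - B))
    (β := Complex.normSq (C - A)) (γ := Complex.normSq (B - A))
    hx hy hz hx₂ hy₂ hz₂ hcross hfP hfQ (by
      refine mul_left_cancel₀ hk ?_
      rw [hx', hy', hz'] at hdet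
      linear_combination hdet)
  have hgrad : conicGrad a b c d e f P ≠ 0 := by
    intro h0
    have gA := conicGrad_barycentric bP bA hAS hBS hCS hPS
    have gB := conicGrad_barycentric bP bB hAS hBS hCS hPS
    have gC := conicGrad_barycentric bP bC hAS hBS hCS hPS
    simp only [h0, Complex.zero_re, Complex.zero_im, mul_zero, mul_one, add_zero, zero_add,
      zero_eq_neg] at gA gB gC
    have hp : conicEval a b c 0 0 0 (C - B) = 0 := by
      refine mul_left_cancel₀ (mul_ne_zero (mul_ne_zero two_ne_zero hy) hz) ?_
      linear_combination (-x) * gA + y * gB + z * gC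
    have hq : conicEval a b c 0 0 0 (C - A) = 0 := by
      refine mul_left_cancel₀ hx ?_
      linear_combination gC - y * hp
    have hr : conicEval a b c 0 0 0 (B - A) = 0 := by
      refine mul_left_cancel₀ hy ?_
      linear_combination gA - z * hq
    refine hne (conicEval_coeffs_eq_zero fun X => ?_)
    obtain ⟨s, u, v, bX⟩ := exists_hasBarycentric hD X
    rw [conicEval_barycentric bX hAS hBS hCS, hp, hq, hr]
    ring
  refine ⟨a, b, c, d, e, f, hne, rfl, hPS, hgrad, lineThrough_eq_perpLineAt hQ'P hgrad ?_⟩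
  rw [conicGrad_barycentric bP bQ' hAS hBS hCS hPS, hx₂', hy₂', hz₂']
  linear_combination (-m) * hpolar

end
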